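/- Let x: U → ℝ³ be a smooth immersed surface with unit normal N, and suppose {e_1, e_2} is a smooth orthonormal tangent frame with A e_1 = a e_1 and A e_2 = b e_2, where A is the shape operator of x. Let f(p,t) = (x(p), t·N(p)) be the normal bundle immersion. Then the mean curvature vector of f at (p,t) is H = −( P t² a e_1 + Q t² b e_2 − R N , P t e_1 + Q t e_2 ) ∈ ℝ³ × ℝ³, where P = (1+t²a²)^{−2} e_1a + (1+t²a²)^{−1}(1+t²b²)^{−1} e_1b, Q = (1+t²a²)^{−1}(1+t²b²)^{−1} e_2a + (1+t²b²)^{−2} e_2b, and R = a(1+t²a²)^{−1} + b(1+t²b²)^{−1}; moreover JH = f_*( tP e_1 + tQ e_2 + R ∂/∂t ), i.e., JH is the pushforward of the tangent vector field tP e_1 + tQ e_2 + R ∂/∂t on U × ℝ. -/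

import Mathlib

noncomputable section

open scoped InnerProductSpace

/-- Euclidean 3-space. -/
abbrev E3 : Type := EuclideanSpace ℝ (Fin 3)

/-- ℝ⁶ = ℝ³ × ℝ³, identified with ℂ³. -/
abbrev V6 : Type := E3 × E3

/-- The domain of the normal bundle immersion: ℝ² × ℝ. -/
abbrev W3 : Type := (ℝ × ℝ) × ℝ

/-- The standard inner product on ℝ⁶ = ℝ³ × ℝ³. -/
def ip6 (v w : V6) : ℝ := ⟪v.1, w.1⟫_ℝ + ⟪v.2, w.2⟫_ℝ

/-- The complex structure J(X, Y) = (−Y, X) on ℝ³ × ℝ³ = ℂ³. -/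
def Jc (v : V6) : V6 := (-v.2, v.1)

/-- The normal bundle immersion f(p, t) = (x(p), t·N(p)). -/
def nbi (x N : ℝ × ℝ → E3) : W3 → V6 := fun q => (x q.1, q.2 • N q.1)

/-- Second derivative of `g` at `q` in directions `v`, `w`. -/
def d2 (g : W3 → V6) (q v w : W3) : V6 := fderiv ℝ (fun y => fderiv ℝ g y w) q v

/-- `n` is orthogonal to the tangent space (range of the differential) of `g` at `q`. -/
def IsNormalAt (g : W3 → V6) (q : W3) (n : V6) : Prop :=
  ∀ v : W3, ip6 n (fderiv ℝ g q v) = 0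

/-- `n` is the second fundamental form `h(v, w)` of `g` at `q`: the orthogonal projection of
the second derivative in directions `v`, `w` onto the orthogonal complement of the tangent
space. -/
def IsSFF (g : W3 → V6) (q v w : W3) (n : V6) : Prop :=
  IsNormalAt g q n ∧ d2 g q v w - n ∈ Set.range ⇑(fderiv ℝ g q)

/-- `v₁, v₂, v₃` is an orthonormal frame at `q` for the metric induced by `g`. -/
def ONFrame (g : W3 → V6) (q : W3) (v₁ v₂ v₃ : W3) : Prop :=
  ip6 (fderiv ℝ g q v₁) (fderiv ℝ g q v₁) = 1 ∧
  ip6 (fderiv ℝ g q v₂) (fderiv ℝ g q v₂) = 1 ∧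
  ip6 (fderiv ℝ g q v₃) (fderiv ℝ g q v₃) = 1 ∧
  ip6 (fderiv ℝ g q v₁) (fderiv ℝ g q v₂) = 0 ∧
  ip6 (fderiv ℝ g q v₁) (fderiv ℝ g q v₃) = 0 ∧
  ip6 (fderiv ℝ g q v₂) (fderiv ℝ g q v₃) = 0

/-- `Hq` is the mean curvature vector of `g` at `q`:
`H = Σᵢ h(ẽᵢ, ẽᵢ)` for an orthonormal frame `ẽ₁, ẽ₂, ẽ₃` of the induced metric. -/
def IsMeanCurvAt (g : W3 → V6) (q : W3) (Hq : V6) : Prop :=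
  ∃ v₁ v₂ v₃ : W3, ONFrame g q v₁ v₂ v₃ ∧
    ∃ n₁ n₂ n₃ : V6, IsSFF g q v₁ v₁ n₁ ∧ IsSFF g q v₂ v₂ n₂ ∧ IsSFF g q v₃ v₃ n₃ ∧
      Hq = n₁ + n₂ + n₃

/-- `u = A_ξ v`, the shape operator of `g` at `q` with respect to the normal vector `ξ`,
characterized by `⟨dg(A_ξ v), dg(w)⟩ = ⟨h(v, w), ξ⟩` for all `w`. -/
def IsShapeAt (g : W3 → V6) (q : W3) (ξ : V6) (v u : W3) : Prop :=
  ∀ w : W3, ∀ n : V6, IsSFF g q v w n →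
    ip6 (fderiv ℝ g q u) (fderiv ℝ g q w) = ip6 n ξ

/-- `g` is a Lagrangian immersion at `q`: the differential is injective and `J` maps the
tangent space onto its orthogonal complement. -/
def LagrangianAt (g : W3 → V6) (q : W3) : Prop :=
  Function.Injective ⇑(fderiv ℝ g q) ∧
    Jc '' Set.range ⇑(fderiv ℝ g q) =
      {u : V6 | ∀ w ∈ Set.range ⇑(fderiv ℝ g q), ip6 u w = 0}

/-- The Maslovian condition at `q` for the mean curvature vector `Hq`: `Hq ≠ 0` and
`A_H(JH)` is a real scalar multiple of `JH` (expressed via the tangent vector `V`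
with `dg(V) = J Hq`). -/
def MaslovianAt (g : W3 → V6) (q : W3) (Hq : V6) : Prop :=
  Hq ≠ 0 ∧ ∀ V u : W3, fderiv ℝ g q V = Jc Hq → IsShapeAt g q Hq V u → ∃ c : ℝ, u = c • V

/-- Standard hypotheses: `U` is a connected open set, `x` is a smooth immersion on `U`, and
`N` is a smooth unit normal field along `x` on `U`. -/
structure SurfaceData (U : Set (ℝ × ℝ)) (x N : ℝ × ℝ → E3) : Prop where
  open_U : IsOpen U
  conn_U : IsConnected U
  smooth_x : ContDiffOn ℝ (⊤ : ℕ∞) x U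
  smooth_N : ContDiffOn ℝ (⊤ : ℕ∞) N U
  immersion : ∀ p ∈ U, Function.Injective ⇑(fderiv ℝ x p)
  unit_N : ∀ p ∈ U, ‖N p‖ = 1
  normal_N : ∀ p ∈ U, ∀ v : ℝ × ℝ, ⟪N p, fderiv ℝ x p v⟫_ℝ = 0

/-- `x` is minimal at `p`: the trace of the shape operator `A = −dN ∘ dx⁻¹` vanishes,
expressed via orthonormal frames of the induced metric. -/
def SurfMinimalAt (x N : ℝ × ℝ → E3) (p : ℝ × ℝ) : Prop :=
  ∀ v₁ v₂ : ℝ × ℝ,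
    ⟪fderiv ℝ x p v₁, fderiv ℝ x p v₁⟫_ℝ = 1 →
    ⟪fderiv ℝ x p v₂, fderiv ℝ x p v₂⟫_ℝ = 1 →
    ⟪fderiv ℝ x p v₁, fderiv ℝ x p v₂⟫_ℝ = 0 →
    ⟪fderiv ℝ N p v₁, fderiv ℝ x p v₁⟫_ℝ + ⟪fderiv ℝ N p v₂, fderiv ℝ x p v₂⟫_ℝ = 0

/-- A rigid motion of ℝ³: `y ↦ S y + c` with `S ∈ SO(3)`. -/
def RigidMotion (Φ : E3 → E3) : Prop :=
  ∃ (S : E3 ≃ₗᵢ[ℝ] E3) (c : E3),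
    LinearMap.det (S.toLinearEquiv : E3 →ₗ[ℝ] E3) = 1 ∧ ∀ y, Φ y = S y + c

/-- The circular cone `C_r = {(s·r·cos θ, s·r·sin θ, s)/√(r²+1) : s > 0, θ ∈ ℝ}`. -/
def coneSet (r : ℝ) : Set E3 :=
  { y | ∃ s θ : ℝ, 0 < s ∧
      y 0 = s * r * Real.cos θ / Real.sqrt (r ^ 2 + 1) ∧
      y 1 = s * r * Real.sin θ / Real.sqrt (r ^ 2 + 1) ∧
      y 2 = s / Real.sqrt (r ^ 2 + 1) }

/-- `x(U)` is contained in a round sphere. -/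
def InRoundSphere (U : Set (ℝ × ℝ)) (x : ℝ × ℝ → E3) : Prop :=
  ∃ (c : E3) (ρ : ℝ), 0 < ρ ∧ ∀ p ∈ U, ‖x p - c‖ = ρ

/-- `x(U)` is contained in a circular cylinder. -/
def InCircularCylinder (U : Set (ℝ × ℝ)) (x : ℝ × ℝ → E3) : Prop :=
  ∃ (c w : E3) (ρ : ℝ), ‖w‖ = 1 ∧ 0 < ρ ∧
    ∀ p ∈ U, ‖(x p - c) - ⟪x p - c, w⟫_ℝ • w‖ = ρ

/-- `x(U)` is contained in a circular cone: the image under a rigid motion of `C_r`, `r ≠ 0`. -/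
def InCircularCone (U : Set (ℝ × ℝ)) (x : ℝ × ℝ → E3) : Prop :=
  ∃ r : ℝ, r ≠ 0 ∧ ∃ Φ : E3 → E3, RigidMotion Φ ∧ ∀ p ∈ U, x p ∈ Φ '' coneSet r
theorem ContDiffAt.differentiableAt_fderiv {E F : Type*} [NormedAddCommGroup E] [NormedSpace ℝ E]
    [NormedAddCommGroup F] [NormedSpace ℝ F] {f : E → F} {q : E} (hf : ContDiffAt ℝ 2 f q) :
    DifferentiableAt ℝ (fderiv ℝ f) q :=
  (hf.fderiv_right (m := 1) (by norm_num)).differentiableAt (by norm_num)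

section Trace

variable {ι V F : Type*} [Fintype ι] [DecidableEq ι] [AddCommGroup V] [Module ℝ V]
  [AddCommGroup F] [Module ℝ F]

/-- The trace of a bilinear map `B` with respect to a bilinear form `G` may be computed in any
`G`-orthogonal family spanning a `G`-orthonormal one. -/
theorem sum_bilin_orthonormal_eq (G : V →ₗ[ℝ] V →ₗ[ℝ] ℝ) (B : V →ₗ[ℝ] V →ₗ[ℝ] F)
    (v u : ι → V) (c : Matrix ι ι ℝ) (g : ι → ℝ) (hg : ∀ j, g j ≠ 0)
    (hv : ∀ i, v i = ∑ j, c i j • u j)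
    (hGv : ∀ i k, G (v i) (v k) = if i = k then 1 else 0)
    (hGu : ∀ j k, G (u j) (u k) = if j = k then g j else 0) :
    ∑ i, B (v i) (v i) = ∑ j, (g j)⁻¹ • B (u j) (u j) := by
  have h1 : c * (Matrix.diagonal g * c.transpose) = 1 := by
    ext i k
    have h := hGv i k
    simp only [hv, map_sum, map_smul, LinearMap.sum_apply, LinearMap.smul_apply, hGu,
      smul_eq_mul] at h
    rw [Matrix.one_apply, ← h, Matrix.mul_apply]
    refine Finset.sum_congr rfl fun j _ => ?_
    simp only [Matrix.diagonal_mul, Matrix.transpose_apply, mul_ite, mul_zero,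
      Finset.sum_ite_eq', Finset.mem_univ, if_true]
    ring
  have h2 : Matrix.diagonal g * (c.transpose * c) = 1 := by
    rw [← Matrix.mul_assoc]; exact mul_eq_one_comm.mp h1
  have h3 : ∀ j k, ∑ i, c i j * c i k = if j = k then (g j)⁻¹ else 0 := by
    intro j k
    have h := congrFun (congrFun h2 j) k
    rw [Matrix.diagonal_mul, Matrix.mul_apply, Matrix.one_apply] at h
    simp only [Matrix.transpose_apply] at h
    have hj := hg j
    split_ifs at h ⊢ with hjk
    · field_simp
      linarith
    · exact (mul_eq_zero.mp h).resolve_left hj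
  calc ∑ i, B (v i) (v i) = ∑ i, ∑ j, ∑ k, (c i j * c i k) • B (u j) (u k) := by
        refine Finset.sum_congr rfl fun i _ => ?_
        simp only [hv, map_sum, map_smul, LinearMap.sum_apply, LinearMap.smul_apply,
          Finset.smul_sum, smul_smul]
        rw [Finset.sum_comm]
        refine Finset.sum_congr rfl fun j _ => Finset.sum_congr rfl fun k _ => ?_
        rw [mul_comm]
    _ = ∑ j, ∑ k, (∑ i, c i j * c i k) • B (u j) (u k) := by
        rw [Finset.sum_comm]
        refine Finset.sum_congr rfl fun j _ => ?_
        rw [Finset.sum_comm]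
        exact Finset.sum_congr rfl fun k _ => (Finset.sum_smul).symm
    _ = ∑ j, (g j)⁻¹ • B (u j) (u j) := by
        simp [h3]

end Trace

/-- `ip6` as a bilinear map. -/
def ip6Bilin : V6 →ₗ[ℝ] V6 →ₗ[ℝ] ℝ :=
  LinearMap.mk₂ ℝ ip6
    (fun u v w => by simp only [ip6, Prod.fst_add, Prod.snd_add, inner_add_left]; ring)
    (fun c v w => by
      simp only [ip6, Prod.smul_fst, Prod.smul_snd, real_inner_smul_left, smul_eq_mul]; ring)
    (fun u v w => by simp only [ip6, Prod.fst_add, Prod.snd_add, inner_add_right]; ring)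
    (fun c v w => by
      simp only [ip6, Prod.smul_fst, Prod.smul_snd, real_inner_smul_right, smul_eq_mul]; ring)

theorem ip6Bilin_apply (v w : V6) : ip6Bilin v w = ip6 v w := rfl

/-- A vector of `E3` is determined by its products with three orthonormal vectors. -/
theorem E3.ext_inner_orthonormal {e : Fin 3 → E3} (he : Orthonormal ℝ e) {y z : E3}
    (h : ∀ i, ⟪y, e i⟫_ℝ = ⟪z, e i⟫_ℝ) : y = z := by
  have hc : Fintype.card (Fin 3) = Module.finrank ℝ E3 := by simp
  refine InnerProductSpace.ext_inner_right_basis (𝕜 := ℝ)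
    (basisOfOrthonormalOfCardEqFinrank he hc) fun i => ?_
  rw [coe_basisOfOrthonormalOfCardEqFinrank]
  exact h i

/-- Two vectors of the plane with orthonormal images under a linear map span the plane. -/
theorem exists_eq_smul_add_smul_of_orthonormal_image (L : ℝ × ℝ →L[ℝ] E3) {X Y : ℝ × ℝ}
    (h11 : ⟪L X, L X⟫_ℝ = 1) (h22 : ⟪L Y, L Y⟫_ℝ = 1) (h12 : ⟪L X, L Y⟫_ℝ = 0) (v : ℝ × ℝ) :
    ∃ r s : ℝ, v = r • X + s • Y := by
  have hli : LinearIndependent ℝ ![X, Y] := by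
    rw [LinearIndependent.pair_iff]
    intro r s hrs
    have h0 : r • L X + s • L Y = 0 := by
      rw [← map_smul, ← map_smul, ← map_add, hrs, map_zero]
    have h1 : ⟪r • L X + s • L Y, L X⟫_ℝ = 0 := by rw [h0, inner_zero_left]
    have h2 : ⟪r • L X + s • L Y, L Y⟫_ℝ = 0 := by rw [h0, inner_zero_left]
    rw [inner_add_left, real_inner_smul_left, real_inner_smul_left] at h1 h2
    rw [real_inner_comm] at h12
    rw [h12, h11] at h1
    rw [real_inner_comm, h12, h22] at h2
    constructor <;> linarith
  have hc : Fintype.card (Fin 2) = Module.finrank ℝ (ℝ × ℝ) := by simp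
  let b := basisOfLinearIndependentOfCardEqFinrank hli hc
  refine ⟨b.repr v 0, b.repr v 1, ?_⟩
  conv_lhs => rw [← b.sum_repr v]
  simp [b, Fin.sum_univ_two]

section NormalBundle

variable {x N : ℝ × ℝ → E3}

theorem fderiv_nbi_apply {q : W3} (hx : DifferentiableAt ℝ x q.1) (hN : DifferentiableAt ℝ N q.1)
    (w : W3) :
    fderiv ℝ (nbi x N) q w =
      (fderiv ℝ x q.1 w.1, q.2 • fderiv ℝ N q.1 w.1 + w.2 • N q.1) := by
  have h1 : HasFDerivAt (fun y : W3 => x y.1) _ q := hx.hasFDerivAt.comp q hasFDerivAt_fst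
  have h2 : HasFDerivAt (fun y : W3 => N y.1) _ q := hN.hasFDerivAt.comp q hasFDerivAt_fst
  have h3 := h1.prodMk ((hasFDerivAt_snd (𝕜 := ℝ) (p := q)).smul h2)
  have h4 : HasFDerivAt (nbi x N) _ q := h3
  rw [h4.fderiv]
  simp

theorem contDiffAt_nbi {q : W3} {n : WithTop ℕ∞} (hx : ContDiffAt ℝ n x q.1)
    (hN : ContDiffAt ℝ n N q.1) : ContDiffAt ℝ n (nbi x N) q :=
  (hx.comp q contDiffAt_fst).prodMk (contDiffAt_snd.smul (hN.comp q contDiffAt_fst))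

theorem d2_eq_fderiv_fderiv {g : W3 → V6} {q : W3} (hg : ContDiffAt ℝ 2 g q) (v w : W3) :
    d2 g q v w = fderiv ℝ (fderiv ℝ g) q v w := by
  have h : DifferentiableAt ℝ (fderiv ℝ g) q :=
    hg.differentiableAt_fderiv
  rw [d2, (h.hasFDerivAt.clm_apply (hasFDerivAt_const w q)).fderiv]
  simp

theorem d2_nbi_apply {q : W3} (hx : ContDiffAt ℝ 2 x q.1) (hN : ContDiffAt ℝ 2 N q.1)
    (v w : W3) :
    d2 (nbi x N) q v w =
      (fderiv ℝ (fderiv ℝ x) q.1 v.1 w.1,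
        q.2 • fderiv ℝ (fderiv ℝ N) q.1 v.1 w.1 + v.2 • fderiv ℝ N q.1 w.1
          + w.2 • fderiv ℝ N q.1 v.1) := by
  have hx' : DifferentiableAt ℝ (fderiv ℝ x) q.1 :=
    hx.differentiableAt_fderiv
  have hN' : DifferentiableAt ℝ (fderiv ℝ N) q.1 :=
    hN.differentiableAt_fderiv
  have hev : (fun y => fderiv ℝ (nbi x N) y w) =ᶠ[nhds q] fun y =>
      (fderiv ℝ x y.1 w.1, y.2 • fderiv ℝ N y.1 w.1 + w.2 • N y.1) := by
    have e1 := (continuous_fst.tendsto q).eventually (hx.eventually (by simp))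
    have e2 := (continuous_fst.tendsto q).eventually (hN.eventually (by simp))
    filter_upwards [e1, e2] with y h1 h2
    exact fderiv_nbi_apply (h1.differentiableAt (by norm_num))
      (h2.differentiableAt (by norm_num)) w
  have hX : HasFDerivAt (fun y : W3 => fderiv ℝ x y.1 w.1) _ q :=
    (hx'.hasFDerivAt.comp q hasFDerivAt_fst).clm_apply (hasFDerivAt_const w.1 q)
  have hN1 : HasFDerivAt (fun y : W3 => fderiv ℝ N y.1 w.1) _ q :=
    (hN'.hasFDerivAt.comp q hasFDerivAt_fst).clm_apply (hasFDerivAt_const w.1 q)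
  have hN0 : HasFDerivAt (fun y : W3 => N y.1) _ q :=
    (hN.differentiableAt (by norm_num)).hasFDerivAt.comp q hasFDerivAt_fst
  have h := hX.prodMk (((hasFDerivAt_snd (𝕜 := ℝ) (p := q)).smul hN1).add (hN0.const_smul w.2))
  rw [d2, hev.fderiv_eq]
  have h' := h.fderiv
  simp only [Pi.add_def, Pi.smul_def, Pi.smul_apply'] at h'
  erw [h']
  simp

end NormalBundle

section Codazzi

variable {U : Set (ℝ × ℝ)} {x N : ℝ × ℝ → E3} {p : ℝ × ℝ}

/-- The second fundamental form is minus the product of the differentials of `x` and `N`. -/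
theorem SurfaceData.inner_normal_snd_fderiv (hS : SurfaceData U x N) (hp : p ∈ U) (v w : ℝ × ℝ) :
    ⟪N p, fderiv ℝ (fderiv ℝ x) p v w⟫_ℝ = -⟪fderiv ℝ N p v, fderiv ℝ x p w⟫_ℝ := by
  have hU := hS.open_U.mem_nhds hp
  have hx' : DifferentiableAt ℝ (fderiv ℝ x) p :=
    (contDiffAt_infty.mp (hS.smooth_x.contDiffAt hU) 2).differentiableAt_fderiv
  have hN : DifferentiableAt ℝ N p := (hS.smooth_N.contDiffAt hU).differentiableAt (by simp)
  have h := (hN.hasFDerivAt.inner ℝ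
    (hx'.hasFDerivAt.clm_apply (hasFDerivAt_const w p))).fderiv
  have h0 : (fun y => ⟪N y, fderiv ℝ x y w⟫_ℝ) =ᶠ[nhds p] fun _ => 0 := by
    filter_upwards [hU] with y hy using hS.normal_N y hy w
  rw [h0.fderiv_eq] at h
  have h1 := DFunLike.congr_fun h v
  simp at h1
  linarith

theorem SurfaceData.inner_fderiv_comm (hS : SurfaceData U x N) (hp : p ∈ U) (v w : ℝ × ℝ) :
    ⟪fderiv ℝ N p v, fderiv ℝ x p w⟫_ℝ = ⟪fderiv ℝ x p v, fderiv ℝ N p w⟫_ℝ := by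
  have hsymm : fderiv ℝ (fderiv ℝ x) p v w = fderiv ℝ (fderiv ℝ x) p w v :=
    (contDiffAt_infty.mp (hS.smooth_x.contDiffAt (hS.open_U.mem_nhds hp)) 2).isSymmSndFDerivAt
      (by simp) v w
  have h1 := hS.inner_normal_snd_fderiv hp v w
  have h2 := hS.inner_normal_snd_fderiv hp w v
  rw [hsymm] at h1
  rw [real_inner_comm (fderiv ℝ N p w)]
  linarith

theorem SurfaceData.fderiv_inner_fderiv_comm (hS : SurfaceData U x N) (hp : p ∈ U)
    (u v w : ℝ × ℝ) :
    ⟪fderiv ℝ (fderiv ℝ N) p u v, fderiv ℝ x p w⟫_ℝ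
        + ⟪fderiv ℝ N p v, fderiv ℝ (fderiv ℝ x) p u w⟫_ℝ =
      ⟪fderiv ℝ (fderiv ℝ x) p u v, fderiv ℝ N p w⟫_ℝ
        + ⟪fderiv ℝ x p v, fderiv ℝ (fderiv ℝ N) p u w⟫_ℝ := by
  have hU := hS.open_U.mem_nhds hp
  have hx' : DifferentiableAt ℝ (fderiv ℝ x) p :=
    (contDiffAt_infty.mp (hS.smooth_x.contDiffAt hU) 2).differentiableAt_fderiv
  have hN' : DifferentiableAt ℝ (fderiv ℝ N) p :=
    (contDiffAt_infty.mp (hS.smooth_N.contDiffAt hU) 2).differentiableAt_fderiv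
  have hX := fun w => hx'.hasFDerivAt.clm_apply (hasFDerivAt_const w p)
  have hN := fun w => hN'.hasFDerivAt.clm_apply (hasFDerivAt_const w p)
  have h1 := ((hN v).inner ℝ (hX w)).fderiv
  have h2 := ((hX v).inner ℝ (hN w)).fderiv
  have h0 : (fun y => ⟪fderiv ℝ N y v, fderiv ℝ x y w⟫_ℝ) =ᶠ[nhds p]
      fun y => ⟪fderiv ℝ x y v, fderiv ℝ N y w⟫_ℝ := by
    filter_upwards [hU] with y hy using hS.inner_fderiv_comm hy v w
  rw [h0.fderiv_eq, h2] at h1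
  have h3 := DFunLike.congr_fun h1 u
  simp at h3
  linarith

/-- Derivative of a principal curvature along a principal field. -/
theorem SurfaceData.fderiv_principal (hS : SurfaceData U x N) {E : ℝ × ℝ → ℝ × ℝ}
    {a : ℝ × ℝ → ℝ} (hE : ContDiffOn ℝ (⊤ : ℕ∞) E U)
    (hunit : ∀ p ∈ U, ⟪fderiv ℝ x p (E p), fderiv ℝ x p (E p)⟫_ℝ = 1)
    (heig : ∀ p ∈ U, fderiv ℝ N p (E p) = (-(a p)) • fderiv ℝ x p (E p))
    (hp : p ∈ U) (v : ℝ × ℝ) :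
    fderiv ℝ a p v = -(⟪fderiv ℝ (fderiv ℝ N) p v (E p), fderiv ℝ x p (E p)⟫_ℝ
      + a p * ⟪fderiv ℝ (fderiv ℝ x) p v (E p), fderiv ℝ x p (E p)⟫_ℝ) := by
  have hU := hS.open_U.mem_nhds hp
  have hx' : DifferentiableAt ℝ (fderiv ℝ x) p :=
    (contDiffAt_infty.mp (hS.smooth_x.contDiffAt hU) 2).differentiableAt_fderiv
  have hN' : DifferentiableAt ℝ (fderiv ℝ N) p :=
    (contDiffAt_infty.mp (hS.smooth_N.contDiffAt hU) 2).differentiableAt_fderiv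
  have hE' : DifferentiableAt ℝ E p := (hE.contDiffAt hU).differentiableAt (by simp)
  have hX := hx'.hasFDerivAt.clm_apply hE'.hasFDerivAt
  have hN := hN'.hasFDerivAt.clm_apply hE'.hasFDerivAt
  have h1 : HasFDerivAt (fun y => -⟪fderiv ℝ N y (E y), fderiv ℝ x y (E y)⟫_ℝ) _ p :=
    (hN.inner ℝ hX).neg
  have h0 : a =ᶠ[nhds p] fun y => -⟪fderiv ℝ N y (E y), fderiv ℝ x y (E y)⟫_ℝ := by
    filter_upwards [hU] with y hy
    rw [heig y hy, real_inner_smul_left, hunit y hy]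
    ring
  have h2 : (fun y => ⟪fderiv ℝ x y (E y), fderiv ℝ x y (E y)⟫_ℝ) =ᶠ[nhds p] fun _ => 1 := by
    filter_upwards [hU] with y hy using hunit y hy
  have h3 := (hX.inner ℝ hX).fderiv
  rw [h2.fderiv_eq] at h3
  have h4 := DFunLike.congr_fun h3 v
  have hc := hS.inner_fderiv_comm hp (fderiv ℝ E p v) (E p)
  rw [h0.fderiv_eq, h1.fderiv]
  simp [heig p hp, inner_add_left, inner_add_right, real_inner_smul_left,
    real_inner_smul_right] at h4 hc ⊢
  rw [real_inner_comm (fderiv ℝ (fderiv ℝ x) p v (E p)),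
    real_inner_comm (fderiv ℝ x p (fderiv ℝ E p v))] at h4 ⊢
  linear_combination (-1) * hc - a p * h4

end Codazzi

section MeanCurvature

variable {U : Set (ℝ × ℝ)} {x N : ℝ × ℝ → E3} {E₁ E₂ : ℝ × ℝ → ℝ × ℝ} {a b : ℝ × ℝ → ℝ}
  {p : ℝ × ℝ} {t : ℝ} {Hq : V6}

/-- The sum of second derivatives over any orthonormal frame of the normal bundle immersion,
computed in the orthogonal frame induced by a principal frame of the surface. -/
theorem IsMeanCurvAt.exists_nbi_eq (hS : SurfaceData U x N) (hp : p ∈ U) {X Y : ℝ × ℝ}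
    {k l : ℝ} (h11 : ⟪fderiv ℝ x p X, fderiv ℝ x p X⟫_ℝ = 1)
    (h22 : ⟪fderiv ℝ x p Y, fderiv ℝ x p Y⟫_ℝ = 1)
    (h12 : ⟪fderiv ℝ x p X, fderiv ℝ x p Y⟫_ℝ = 0)
    (hX : fderiv ℝ N p X = (-k) • fderiv ℝ x p X)
    (hY : fderiv ℝ N p Y = (-l) • fderiv ℝ x p Y)
    (hH : IsMeanCurvAt (nbi x N) (p, t) Hq) :
    ∃ z : W3, Hq =
      ((1 + t ^ 2 * k ^ 2)⁻¹ • fderiv ℝ (fderiv ℝ x) p X X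
          + (1 + t ^ 2 * l ^ 2)⁻¹ • fderiv ℝ (fderiv ℝ x) p Y Y,
        (1 + t ^ 2 * k ^ 2)⁻¹ • t • fderiv ℝ (fderiv ℝ N) p X X
          + (1 + t ^ 2 * l ^ 2)⁻¹ • t • fderiv ℝ (fderiv ℝ N) p Y Y)
        - fderiv ℝ (nbi x N) (p, t) z := by
  obtain ⟨v₁, v₂, v₃, hv, n₁, n₂, n₃, ⟨-, z₁, hz₁⟩, ⟨-, z₂, hz₂⟩, ⟨-, z₃, hz₃⟩, rfl⟩ := hH
  obtain ⟨o11, o22, o33, o12, o13, o23⟩ := hv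
  have hU := hS.open_U.mem_nhds hp
  have hx2 : ContDiffAt ℝ 2 x p := contDiffAt_infty.mp (hS.smooth_x.contDiffAt hU) 2
  have hN2 : ContDiffAt ℝ 2 N p := contDiffAt_infty.mp (hS.smooth_N.contDiffAt hU) 2
  have hf2 : ContDiffAt ℝ 2 (nbi x N) (p, t) := contDiffAt_nbi hx2 hN2
  have hL := fderiv_nbi_apply (q := (p, t)) (hx2.differentiableAt (by norm_num))
    (hN2.differentiableAt (by norm_num))
  have hd2 := d2_nbi_apply (q := (p, t)) hx2 hN2
  let L : W3 →ₗ[ℝ] V6 := (fderiv ℝ (nbi x N) (p, t)).toLinearMap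
  let B : W3 →ₗ[ℝ] W3 →ₗ[ℝ] V6 := (fderiv ℝ (fderiv ℝ (nbi x N)) (p, t)).toLinearMap₁₂
  have hB : ∀ v w, B v w = d2 (nbi x N) (p, t) v w := fun v w =>
    (d2_eq_fderiv_fderiv hf2 v w).symm
  have hG : ∀ v w, ip6Bilin.compl₁₂ L L v w =
      ip6 (fderiv ℝ (nbi x N) (p, t) v) (fderiv ℝ (nbi x N) (p, t) w) := fun v w => rfl
  have hcomm : ∀ v w, ip6 v w = ip6 w v := fun v w => by
    simp only [ip6, real_inner_comm]
  have hn := hS.unit_N p hp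
  have hnX := hS.normal_N p hp X
  have hnY := hS.normal_N p hp Y
  have hnX' := hnX
  have hnY' := hnY
  have h21 := h12
  have hnormX : ‖fderiv ℝ x p X‖ = 1 := by
    rw [norm_eq_sqrt_real_inner, h11, Real.sqrt_one]
  have hnormY : ‖fderiv ℝ x p Y‖ = 1 := by
    rw [norm_eq_sqrt_real_inner, h22, Real.sqrt_one]
  rw [real_inner_comm] at hnX' hnY' h21
  choose r s hrs using exists_eq_smul_add_smul_of_orthonormal_image (fderiv ℝ x p) h11 h22 h12
  have key := sum_bilin_orthonormal_eq (ip6Bilin.compl₁₂ L L) B ![v₁, v₂, v₃]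
    ![(X, 0), (Y, 0), (0, 1)] (Matrix.of fun i => ![r (![v₁, v₂, v₃] i).1,
      s (![v₁, v₂, v₃] i).1, (![v₁, v₂, v₃] i).2])
    ![1 + t ^ 2 * k ^ 2, 1 + t ^ 2 * l ^ 2, 1]
    (by intro j; fin_cases j <;> simp <;> positivity)
    (by
      intro i
      refine Prod.ext ?_ ?_
      · simpa [Fin.sum_univ_three] using hrs _
      · simp [Fin.sum_univ_three])
    (by
      intro i j
      rw [hG]
      fin_cases i <;> fin_cases j <;> simp [o11, o22, o33, o12, o13, o23] <;>
        (rw [hcomm]; assumption))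
    (by
      intro i j
      rw [hG, hL, hL]
      fin_cases i <;> fin_cases j <;>
        simp [ip6, hX, hY, real_inner_smul_left, real_inner_smul_right, h12, h21,
          hnX, hnY, hnX', hnY', hn, hnormX, hnormY, norm_smul, mul_pow])
  simp only [hB, Fin.sum_univ_three, Matrix.cons_val] at key
  refine ⟨z₁ + z₂ + z₃, ?_⟩
  rw [hd2 (X, 0), hd2 (Y, 0), hd2 (0, 1)] at key
  simp only [map_zero, zero_smul, smul_zero, add_zero,
    Prod.smul_mk, Prod.mk_add_mk] at key
  rw [map_add, map_add, hz₁, hz₂, hz₃, ← key]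
  abel

theorem IsMeanCurvAt.isNormalAt {g : W3 → V6} {q : W3} {n : V6} (h : IsMeanCurvAt g q n) :
    IsNormalAt g q n := by
  obtain ⟨v₁, v₂, v₃, -, n₁, n₂, n₃, ⟨h₁, -⟩, ⟨h₂, -⟩, ⟨h₃, -⟩, rfl⟩ := h
  intro v
  have e₁ := h₁ v
  have e₂ := h₂ v
  have e₃ := h₃ v
  rw [← ip6Bilin_apply] at e₁ e₂ e₃ ⊢
  rw [map_add, map_add, LinearMap.add_apply, LinearMap.add_apply, e₁, e₂, e₃]
  simp

/-- The components along a principal direction of the mean curvature vector of the normal bundle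
immersion. -/
theorem IsMeanCurvAt.inner_principal (hS : SurfaceData U x N)
    (hE₁ : ContDiffOn ℝ (⊤ : ℕ∞) E₁ U) (hE₂ : ContDiffOn ℝ (⊤ : ℕ∞) E₂ U)
    (h11 : ∀ p ∈ U, ⟪fderiv ℝ x p (E₁ p), fderiv ℝ x p (E₁ p)⟫_ℝ = 1)
    (h22 : ∀ p ∈ U, ⟪fderiv ℝ x p (E₂ p), fderiv ℝ x p (E₂ p)⟫_ℝ = 1)
    (h12 : ∀ p ∈ U, ⟪fderiv ℝ x p (E₁ p), fderiv ℝ x p (E₂ p)⟫_ℝ = 0)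
    (heig₁ : ∀ p ∈ U, fderiv ℝ N p (E₁ p) = (-(a p)) • fderiv ℝ x p (E₁ p))
    (heig₂ : ∀ p ∈ U, fderiv ℝ N p (E₂ p) = (-(b p)) • fderiv ℝ x p (E₂ p))
    (hp : p ∈ U) (hH : IsMeanCurvAt (nbi x N) (p, t) Hq) {P : ℝ}
    (hP : P = fderiv ℝ a p (E₁ p) / (1 + t ^ 2 * a p ^ 2) ^ 2 +
      fderiv ℝ b p (E₁ p) / ((1 + t ^ 2 * a p ^ 2) * (1 + t ^ 2 * b p ^ 2))) :
    ⟪Hq.1, fderiv ℝ x p (E₁ p)⟫_ℝ = -(P * t ^ 2 * a p) ∧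
      ⟪Hq.2, fderiv ℝ x p (E₁ p)⟫_ℝ = -(P * t) := by
  have hU := hS.open_U.mem_nhds hp
  have hx2 : ContDiffAt ℝ 2 x p := contDiffAt_infty.mp (hS.smooth_x.contDiffAt hU) 2
  have hN2 : ContDiffAt ℝ 2 N p := contDiffAt_infty.mp (hS.smooth_N.contDiffAt hU) 2
  have hL := fderiv_nbi_apply (q := (p, t)) (hx2.differentiableAt (by norm_num))
    (hN2.differentiableAt (by norm_num))
  have hnormal := hH.isNormalAt (E₁ p, 0)
  obtain ⟨z, hz⟩ := hH.exists_nbi_eq hS hp (h11 p hp) (h22 p hp) (h12 p hp) (heig₁ p hp)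
    (heig₂ p hp)
  rw [hL, ip6] at hnormal
  rw [hL] at hz
  have hH1 := congrArg (fun y : V6 => ⟪y.1, fderiv ℝ x p (E₁ p)⟫_ℝ) hz
  have hH2 := congrArg (fun y : V6 => ⟪y.2, fderiv ℝ x p (E₁ p)⟫_ℝ) hz
  have hn := hS.normal_N p hp (E₁ p)
  have hzz := hS.inner_fderiv_comm hp z.1 (E₁ p)
  have hxs : fderiv ℝ (fderiv ℝ x) p (E₂ p) (E₁ p) = fderiv ℝ (fderiv ℝ x) p (E₁ p) (E₂ p) :=
    hx2.isSymmSndFDerivAt (by simp) _ _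
  have hNs : fderiv ℝ (fderiv ℝ N) p (E₂ p) (E₁ p) = fderiv ℝ (fderiv ℝ N) p (E₁ p) (E₂ p) :=
    hN2.isSymmSndFDerivAt (by simp) _ _
  have ha := hS.fderiv_principal hE₁ h11 heig₁ hp (E₁ p)
  have hb := hS.fderiv_principal hE₂ h22 heig₂ hp (E₁ p)
  have hcod := hS.fderiv_inner_fderiv_comm hp (E₂ p) (E₂ p) (E₁ p)
  rw [hxs, hNs, real_inner_comm (fderiv ℝ (fderiv ℝ N) p (E₁ p) (E₂ p))] at hcod
  simp only [heig₁ p hp, heig₂ p hp, Prod.fst_sub, Prod.snd_sub, inner_sub_left, inner_add_left,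
    real_inner_smul_left, real_inner_smul_right, hn, mul_zero, add_zero, zero_smul]
    at hnormal hH1 hH2 hzz hcod
  rw [real_inner_comm (fderiv ℝ (fderiv ℝ x) p (E₁ p) (E₂ p))] at hcod
  rw [hzz] at hH2
  have hα : 1 + t ^ 2 * a p ^ 2 ≠ 0 := by positivity
  have hβ : 1 + t ^ 2 * b p ^ 2 ≠ 0 := by positivity
  have hsum : ⟪Hq.2, fderiv ℝ x p (E₁ p)⟫_ℝ + t * a p * ⟪Hq.1, fderiv ℝ x p (E₁ p)⟫_ℝ =
      -(P * t) * (1 + t ^ 2 * a p ^ 2) := by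
    rw [hH1, hH2, hP, ha, hb]
    field_simp
    linear_combination (t * (1 + t ^ 2 * a p ^ 2)) * hcod
  have h2 : ⟪Hq.2, fderiv ℝ x p (E₁ p)⟫_ℝ = -(P * t) := by
    refine mul_right_cancel₀ hα ?_
    linear_combination hsum - t * a p * hnormal
  exact ⟨by linear_combination hnormal + t * a p * h2, h2⟩

/-- The components along the normal of the mean curvature vector of the normal bundle
immersion. -/
theorem IsMeanCurvAt.inner_normal (hS : SurfaceData U x N) (hp : p ∈ U) {X Y : ℝ × ℝ}
    {k l : ℝ} (h11 : ⟪fderiv ℝ x p X, fderiv ℝ x p X⟫_ℝ = 1)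
    (h22 : ⟪fderiv ℝ x p Y, fderiv ℝ x p Y⟫_ℝ = 1)
    (h12 : ⟪fderiv ℝ x p X, fderiv ℝ x p Y⟫_ℝ = 0)
    (hX : fderiv ℝ N p X = (-k) • fderiv ℝ x p X)
    (hY : fderiv ℝ N p Y = (-l) • fderiv ℝ x p Y)
    (hH : IsMeanCurvAt (nbi x N) (p, t) Hq) :
    ⟪Hq.1, N p⟫_ℝ = k / (1 + t ^ 2 * k ^ 2) + l / (1 + t ^ 2 * l ^ 2) ∧
      ⟪Hq.2, N p⟫_ℝ = 0 := by
  have hU := hS.open_U.mem_nhds hp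
  have hL := fderiv_nbi_apply (q := (p, t))
    ((hS.smooth_x.contDiffAt hU).differentiableAt (by simp))
    ((hS.smooth_N.contDiffAt hU).differentiableAt (by simp))
  have hnormal := hH.isNormalAt (0, 1)
  obtain ⟨z, hz⟩ := hH.exists_nbi_eq hS hp h11 h22 h12 hX hY
  have hXX := hS.inner_normal_snd_fderiv hp X X
  have hYY := hS.inner_normal_snd_fderiv hp Y Y
  rw [hX, real_inner_smul_left, h11, real_inner_comm] at hXX
  rw [hY, real_inner_smul_left, h22, real_inner_comm] at hYY
  have hn := hS.normal_N p hp z.1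
  rw [real_inner_comm] at hn
  rw [hL] at hz
  constructor
  · rw [hz]
    simp only [Prod.fst_sub, inner_sub_left, inner_add_left, real_inner_smul_left, hXX, hYY, hn]
    ring
  · simpa [hL, ip6] using hnormal

end MeanCurvature

/-- The mean curvature vector of the normal bundle immersion at `(p, t)`,
in terms of a principal frame `e₁, e₂` with `A e₁ = a e₁`, `A e₂ = b e₂`, is
`H = −(P t² a e₁ + Q t² b e₂ − R N, P t e₁ + Q t e₂)`, and
`J H = f₊(t P e₁ + t Q e₂ + R ∂/∂t)`. -/
theorem normal_bundle_mean_curvature (U : Set (ℝ × ℝ)) (x N : ℝ × ℝ → E3)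
    (hS : SurfaceData U x N) (E₁ E₂ : ℝ × ℝ → ℝ × ℝ) (a b : ℝ × ℝ → ℝ)
    (hE₁ : ContDiffOn ℝ (⊤ : ℕ∞) E₁ U) (hE₂ : ContDiffOn ℝ (⊤ : ℕ∞) E₂ U)
    (hon : ∀ p ∈ U,
      ⟪fderiv ℝ x p (E₁ p), fderiv ℝ x p (E₁ p)⟫_ℝ = 1 ∧
      ⟪fderiv ℝ x p (E₂ p), fderiv ℝ x p (E₂ p)⟫_ℝ = 1 ∧
      ⟪fderiv ℝ x p (E₁ p), fderiv ℝ x p (E₂ p)⟫_ℝ = 0)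
    (heig₁ : ∀ p ∈ U, fderiv ℝ N p (E₁ p) = (-(a p)) • fderiv ℝ x p (E₁ p))
    (heig₂ : ∀ p ∈ U, fderiv ℝ N p (E₂ p) = (-(b p)) • fderiv ℝ x p (E₂ p)) :
    ∀ p ∈ U, ∀ t : ℝ, ∀ Hq : V6, IsMeanCurvAt (nbi x N) (p, t) Hq →
      ∀ P Q R : ℝ,
        P = fderiv ℝ a p (E₁ p) / (1 + t ^ 2 * a p ^ 2) ^ 2 +
            fderiv ℝ b p (E₁ p) / ((1 + t ^ 2 * a p ^ 2) * (1 + t ^ 2 * b p ^ 2)) →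
        Q = fderiv ℝ a p (E₂ p) / ((1 + t ^ 2 * a p ^ 2) * (1 + t ^ 2 * b p ^ 2)) +
            fderiv ℝ b p (E₂ p) / (1 + t ^ 2 * b p ^ 2) ^ 2 →
        R = a p / (1 + t ^ 2 * a p ^ 2) + b p / (1 + t ^ 2 * b p ^ 2) →
        Hq = (-((P * t ^ 2 * a p) • fderiv ℝ x p (E₁ p) +
                (Q * t ^ 2 * b p) • fderiv ℝ x p (E₂ p) - R • N p),
              -((P * t) • fderiv ℝ x p (E₁ p) + (Q * t) • fderiv ℝ x p (E₂ p))) ∧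
        Jc Hq = fderiv ℝ (nbi x N) (p, t) ((t * P) • E₁ p + (t * Q) • E₂ p, R) := by
  intro p hp t Hq hH P Q R hP hQ hR
  have h11 := fun p hp => (hon p hp).1
  have h22 := fun p hp => (hon p hp).2.1
  have h12 := fun p hp => (hon p hp).2.2
  have h21 : ∀ p ∈ U, ⟪fderiv ℝ x p (E₂ p), fderiv ℝ x p (E₁ p)⟫_ℝ = 0 := fun p hp => by
    rw [real_inner_comm, h12 p hp]
  obtain ⟨hP1, hP2⟩ := hH.inner_principal hS hE₁ hE₂ h11 h22 h12 heig₁ heig₂ hp hP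
  obtain ⟨hQ1, hQ2⟩ := hH.inner_principal hS hE₂ hE₁ h22 h11 h21 heig₂ heig₁ hp
    (hQ.trans (by rw [add_comm, mul_comm (1 + t ^ 2 * a p ^ 2)]))
  obtain ⟨hR1, hR2⟩ := hH.inner_normal hS hp (h11 p hp) (h22 p hp) (h12 p hp) (heig₁ p hp)
    (heig₂ p hp)
  rw [← hR] at hR1
  have hn₁ := hS.normal_N p hp (E₁ p)
  have hn₂ := hS.normal_N p hp (E₂ p)
  have hn₁' := hn₁
  have hn₂' := hn₂
  rw [real_inner_comm] at hn₁' hn₂'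
  have hn : ⟪N p, N p⟫_ℝ = 1 := by rw [real_inner_self_eq_norm_sq, hS.unit_N p hp, one_pow]
  have hortho : Orthonormal ℝ ![fderiv ℝ x p (E₁ p), fderiv ℝ x p (E₂ p), N p] := by
    rw [orthonormal_iff_ite]
    intro i j
    fin_cases i <;> fin_cases j <;>
      simp only [Fin.zero_eta, Fin.mk_one, Fin.reduceFinMk, Matrix.cons_val, h11 p hp, h22 p hp,
        h12 p hp, h21 p hp, hn₁, hn₂, hn₁', hn₂', hn] <;> simp
  have hHq : Hq = (-((P * t ^ 2 * a p) • fderiv ℝ x p (E₁ p) +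
      (Q * t ^ 2 * b p) • fderiv ℝ x p (E₂ p) - R • N p),
      -((P * t) • fderiv ℝ x p (E₁ p) + (Q * t) • fderiv ℝ x p (E₂ p))) := by
    refine Prod.ext (E3.ext_inner_orthonormal hortho fun i => ?_)
      (E3.ext_inner_orthonormal hortho fun i => ?_) <;>
    fin_cases i <;>
      simp only [Fin.zero_eta, Fin.mk_one, Fin.reduceFinMk, Matrix.cons_val, inner_neg_left,
        inner_sub_left, inner_add_left, real_inner_smul_left, h11 p hp, h22 p hp, h12 p hp,
        h21 p hp, hn₁, hn₂, hn₁', hn₂', hn, hP1, hP2, hQ1, hQ2, hR1, hR2] <;> ring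
  refine ⟨hHq, ?_⟩
  have hU := hS.open_U.mem_nhds hp
  rw [fderiv_nbi_apply (q := (p, t))
    ((hS.smooth_x.contDiffAt hU).differentiableAt (by simp))
    ((hS.smooth_N.contDiffAt hU).differentiableAt (by simp)), hHq, Jc]
  simp only [map_add, map_smul, heig₁ p hp, heig₂ p hp]
  refine Prod.ext ?_ ?_ <;> dsimp only <;> module
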